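/- arXiv:2104.14084 — 4 statements merged into one kernel-verified Lean document; each statement's English description precedes it below -/
import Mathlib

section
/- For every ε > 0, define F(x₁,x₂,t) := 2 t ε³ sin(x₂) cos(x₂) cos(x₁) exp(−ε² sin²(x₂) t). Then lim_{t→∞} [ (∫_{−π}^{π} ∫_{−π}^{π} F(x₁,x₂,t)² dx₁ dx₂)^{1/2} ] / [ (2π³)^{1/4} ε^{3/2} t^{1/4} ] = 1. -/
open Real Filter MeasureTheory

/-- The second moment of the Gaussian `exp (-v²)`. -/
theorem integral_sq_mul_exp_neg_sq :
    ∫ v : ℝ, v ^ 2 * Real.exp (-v ^ 2) = √π / 2 := by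
  have habs : ∀ v : ℝ, v ^ 2 * Real.exp (-v ^ 2) = |v| ^ 2 * Real.exp (-|v| ^ 2) := by
    intro v; rw [sq_abs]
  rw [funext habs]
  rw [integral_comp_abs (f := fun v : ℝ => v ^ 2 * Real.exp (-v ^ 2))]
  have h := integral_rpow_mul_exp_neg_rpow (p := 2) (q := 2) (by norm_num) (by norm_num)
  simp only [Real.rpow_two] at h
  rw [h, show ((2 : ℝ) + 1) / 2 = 1 / 2 + 1 by norm_num,
    Real.Gamma_add_one (by norm_num), Real.Gamma_one_half_eq]
  ring

theorem integrable_sq_mul_exp_neg_sq :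
    Integrable fun v : ℝ => v ^ 2 * Real.exp (-v ^ 2) := by
  simpa using integrable_rpow_mul_exp_neg_mul_sq (b := 1) one_pos (s := 2) (by norm_num)

/-- The rescaled integrals `∫ v² √(1 - v²/b) exp (-v²)` converge to the Gaussian second moment. -/
theorem tendsto_integral_sq_mul_sqrt_mul_exp :
    Tendsto (fun b : ℝ => ∫ v : ℝ, v ^ 2 * √(1 - v ^ 2 / b) * Real.exp (-v ^ 2))
      atTop (nhds (√π / 2)) := by
  rw [← integral_sq_mul_exp_neg_sq]
  refine tendsto_integral_filter_of_dominated_convergence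
    (fun v : ℝ => v ^ 2 * Real.exp (-v ^ 2)) ?_ ?_ integrable_sq_mul_exp_neg_sq ?_
  · exact .of_forall fun b => (by fun_prop : Measurable _).aestronglyMeasurable
  · filter_upwards [eventually_ge_atTop 0] with b hb
    refine .of_forall fun v => ?_
    rw [Real.norm_of_nonneg (by positivity)]
    have h : √(1 - v ^ 2 / b) ≤ 1 :=
      Real.sqrt_le_one.mpr (by have : 0 ≤ v ^ 2 / b := by positivity
                               linarith)
    gcongr
    exact mul_le_of_le_one_right (sq_nonneg v) h
  · refine .of_forall fun v => ?_
    have h : Tendsto (fun b : ℝ => 1 - v ^ 2 / b) atTop (nhds (1 - 0)) :=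
      tendsto_const_nhds.sub (tendsto_const_nhds.div_atTop tendsto_id)
    have hlim := ((h.sqrt).const_mul (v ^ 2)).mul_const (Real.exp (-v ^ 2))
    simpa using hlim

/-- The substitution `u = sin x` on `[-π/2, π/2]`. -/
theorem integral_sin_sq_mul_cos_sq_mul_exp (b : ℝ) :
    ∫ x in (-(π / 2))..(π / 2),
        Real.sin x ^ 2 * Real.cos x ^ 2 * Real.exp (-b * Real.sin x ^ 2) =
      ∫ u : ℝ, u ^ 2 * √(1 - u ^ 2) * Real.exp (-b * u ^ 2) := by
  have hsub := intervalIntegral.integral_comp_mul_deriv (a := -(π / 2)) (b := π / 2)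
    (f := Real.sin) (f' := Real.cos)
    (g := fun u : ℝ => u ^ 2 * √(1 - u ^ 2) * Real.exp (-b * u ^ 2))
    (fun x _ => Real.hasDerivAt_sin x) Real.continuous_cos.continuousOn (by fun_prop)
  rw [Real.sin_neg, Real.sin_pi_div_two] at hsub
  have hfull : ∫ u in (-1 : ℝ)..1, u ^ 2 * √(1 - u ^ 2) * Real.exp (-b * u ^ 2) =
      ∫ u : ℝ, u ^ 2 * √(1 - u ^ 2) * Real.exp (-b * u ^ 2) := by
    rw [intervalIntegral.integral_of_le (by norm_num)]
    refine setIntegral_eq_integral_of_forall_compl_eq_zero fun u hu => ?_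
    have h : 1 - u ^ 2 ≤ 0 := by
      by_contra! h
      have := abs_lt_of_sq_lt_sq' (by linarith : u ^ 2 < 1 ^ 2) zero_le_one
      exact hu ⟨this.1, this.2.le⟩
    simp [Real.sqrt_eq_zero_of_nonpos h]
  rw [← hfull, ← hsub]
  refine intervalIntegral.integral_congr fun x hx => ?_
  rw [Set.uIcc_of_le (by linarith [Real.pi_pos])] at hx
  have hcos := Real.cos_nonneg_of_mem_Icc hx
  simp only [Function.comp_apply]
  rw [← Real.cos_sq', Real.sqrt_sq hcos]
  ring

/-- The integral over a full period is twice the integral over `[-π/2, π/2]`. -/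
theorem integral_sin_sq_mul_cos_sq_mul_exp_full (b : ℝ) :
    ∫ x in (-π)..π, Real.sin x ^ 2 * Real.cos x ^ 2 * Real.exp (-b * Real.sin x ^ 2) =
      2 * ∫ x in (-(π / 2))..(π / 2),
        Real.sin x ^ 2 * Real.cos x ^ 2 * Real.exp (-b * Real.sin x ^ 2) := by
  set f : ℝ → ℝ := fun x => Real.sin x ^ 2 * Real.cos x ^ 2 * Real.exp (-b * Real.sin x ^ 2)
  have hf : Continuous f := by fun_prop
  have hper : Function.Periodic f π := fun x => by simp [f]
  have h₁ := hper.intervalIntegral_add_eq (-π) (-(π / 2))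
  have h₂ := hper.intervalIntegral_add_eq 0 (-(π / 2))
  rw [show -(π / 2) + π = π / 2 by ring] at h₁ h₂
  rw [neg_add_cancel] at h₁
  rw [zero_add] at h₂
  rw [← intervalIntegral.integral_add_adjacent_intervals (hf.intervalIntegrable (-π) 0)
    (hf.intervalIntegrable 0 π), h₁, h₂]
  ring

/-- Rescaling `u = v / √b`. -/
theorem integral_sq_mul_sqrt_mul_exp_rescale {b : ℝ} (hb : 0 < b) :
    ∫ u : ℝ, u ^ 2 * √(1 - u ^ 2) * Real.exp (-b * u ^ 2) =
      (∫ v : ℝ, v ^ 2 * √(1 - v ^ 2 / b) * Real.exp (-v ^ 2)) / (b * √b) := by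
  have h := Measure.integral_comp_mul_left
    (fun v : ℝ => v ^ 2 * √(1 - v ^ 2 / b) * Real.exp (-v ^ 2)) √b
  have hs : 0 < √b := Real.sqrt_pos.mpr hb
  simp only [mul_pow, Real.sq_sqrt hb.le, mul_div_cancel_left₀ _ hb.ne', smul_eq_mul, mul_assoc,
    integral_const_mul, abs_of_pos (inv_pos.mpr hs)] at h
  simp only [neg_mul, mul_assoc]
  field_simp at h ⊢
  linear_combination h

/-- The squared `L²` norm in terms of the rescaled integral. -/
theorem integral_integral_sq_eq {ε t : ℝ} (hε : 0 < ε) (ht : 0 < t) :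
    ∫ x₂ in (-π)..π, ∫ x₁ in (-π)..π,
        (2 * t * ε ^ 3 * Real.sin x₂ * Real.cos x₂ * Real.cos x₁ *
          Real.exp (-(ε ^ 2) * Real.sin x₂ ^ 2 * t)) ^ 2 =
      (√2 * π * √π * ε ^ 3 * √t) *
        ((∫ v : ℝ, v ^ 2 * √(1 - v ^ 2 / (2 * ε ^ 2 * t)) * Real.exp (-v ^ 2)) / (√π / 2)) := by
  have hpt : ∀ x₂ x₁ : ℝ,
      (2 * t * ε ^ 3 * Real.sin x₂ * Real.cos x₂ * Real.cos x₁ *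
          Real.exp (-(ε ^ 2) * Real.sin x₂ ^ 2 * t)) ^ 2 =
        4 * t ^ 2 * ε ^ 6 * (Real.sin x₂ ^ 2 * Real.cos x₂ ^ 2 *
          Real.exp (-(2 * ε ^ 2 * t) * Real.sin x₂ ^ 2)) * Real.cos x₁ ^ 2 := by
    intro x₂ x₁
    rw [show -(2 * ε ^ 2 * t) * Real.sin x₂ ^ 2 =
      -(ε ^ 2) * Real.sin x₂ ^ 2 * t + -(ε ^ 2) * Real.sin x₂ ^ 2 * t by ring, Real.exp_add]
    ring
  have hcos : ∫ x in (-π)..π, Real.cos x ^ 2 = π := by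
    rw [integral_cos_sq]; simp
  simp_rw [hpt, intervalIntegral.integral_const_mul, hcos, intervalIntegral.integral_mul_const,
    intervalIntegral.integral_const_mul]
  rw [integral_sin_sq_mul_cos_sq_mul_exp_full, integral_sin_sq_mul_cos_sq_mul_exp,
    integral_sq_mul_sqrt_mul_exp_rescale (by positivity)]
  have hsqrt : √(2 * ε ^ 2 * t) = √2 * ε * √t := by
    rw [Real.sqrt_mul (by positivity), Real.sqrt_mul (by norm_num), Real.sqrt_sq hε.le]
  rw [hsqrt]
  have h2 : √2 ^ 2 = (2 : ℝ) := Real.sq_sqrt (by norm_num)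
  have htt : √t ^ 2 = t := Real.sq_sqrt ht.le
  have hπ : 0 < √π := Real.sqrt_pos.mpr Real.pi_pos
  have hst : 0 < √t := Real.sqrt_pos.mpr ht
  field_simp
  rw [h2, htt]
  ring

/-- For every `ε > 0`, with `F(x₁,x₂,t) = 2 t ε³ sin x₂ cos x₂ cos x₁ exp(−ε² sin²x₂ t)`,
the `L²` norm of `F(·,·,t)` over `[−π,π]²` divided by `(2π³)^{1/4} ε^{3/2} t^{1/4}`
tends to `1` as `t → ∞`. -/
theorem stmt_0 (ε : ℝ) (hε : 0 < ε) :
    Tendsto (fun t : ℝ =>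
      (∫ x₂ in (-π)..π, ∫ x₁ in (-π)..π,
          (2 * t * ε ^ 3 * Real.sin x₂ * Real.cos x₂ * Real.cos x₁ *
            Real.exp (-(ε ^ 2) * Real.sin x₂ ^ 2 * t)) ^ 2) ^ ((1 : ℝ) / 2) /
        ((2 * π ^ 3) ^ ((1 : ℝ) / 4) * ε ^ ((3 : ℝ) / 2) * t ^ ((1 : ℝ) / 4)))
      atTop (nhds 1) := by
  have hπ : 0 < √π := Real.sqrt_pos.mpr Real.pi_pos
  have hb : Tendsto (fun t : ℝ => 2 * ε ^ 2 * t) atTop atTop :=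
    tendsto_id.const_mul_atTop (by positivity)
  have hlim := ((tendsto_integral_sq_mul_sqrt_mul_exp.comp hb).div_const (√π / 2)).rpow_const
    (p := (1 : ℝ) / 2) (Or.inr (by norm_num))
  rw [div_self (by positivity), Real.one_rpow] at hlim
  refine hlim.congr' ?_
  filter_upwards [eventually_gt_atTop 0] with t ht
  have hnorm : (√2 * π * √π * ε ^ 3 * √t) ^ ((1 : ℝ) / 2) =
      (2 * π ^ 3) ^ ((1 : ℝ) / 4) * ε ^ ((3 : ℝ) / 2) * t ^ ((1 : ℝ) / 4) := by
    have hπ3 : √2 * π * √π = (2 * π ^ 3) ^ ((1 : ℝ) / 2) := by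
      rw [← Real.sqrt_eq_rpow, Real.sqrt_mul (by norm_num), show π ^ 3 = π ^ 2 * π by ring,
        Real.sqrt_mul (by positivity), Real.sqrt_sq Real.pi_pos.le, mul_assoc]
    rw [hπ3, Real.sqrt_eq_rpow, Real.mul_rpow (by positivity) (by positivity),
      Real.mul_rpow (by positivity) (by positivity), ← Real.rpow_natCast ε 3,
      ← Real.rpow_mul (by positivity), ← Real.rpow_mul hε.le, ← Real.rpow_mul ht.le]
    norm_num
  rw [integral_integral_sq_eq hε ht, Real.mul_rpow (by positivity), hnorm,
    mul_div_cancel_left₀ _ (by positivity)]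
  · rfl
  · exact div_nonneg (integral_nonneg fun v => by positivity) (by positivity)
end

section
/- For every ε > 0, define F(x₁,x₂,t) := 2 t ε³ sin(x₂) cos(x₂) cos(x₁) exp(−ε² sin²(x₂) t). Then lim_{t→∞} [ (∫_{−π}^{π} (sup_{x₂ ∈ [−π,π]} |F(x₁,x₂,t)|)² dx₁)^{1/2} ] / [ (2π/e)^{1/2} ε² t^{1/2} ] = 1, where e is Euler's number. -/
open Real Filter MeasureTheory

/-- The factor of the profile `F(x₁, x₂, t)` that does not involve `x₁`. -/
noncomputable def profile (ε t x : ℝ) : ℝ :=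
  2 * t * ε ^ 3 * Real.sin x * Real.cos x * Real.exp (-(ε ^ 2) * Real.sin x ^ 2 * t)

lemma profile_sq (ε t x : ℝ) :
    profile ε t x ^ 2 = 2 * t * ε ^ 4 * (1 - Real.sin x ^ 2) *
      ((2 * ε ^ 2 * t * Real.sin x ^ 2) * Real.exp (-(2 * ε ^ 2 * t * Real.sin x ^ 2))) := by
  have h : Real.exp (-(2 * ε ^ 2 * t * Real.sin x ^ 2)) =
      Real.exp (-(ε ^ 2) * Real.sin x ^ 2 * t) ^ 2 := by
    rw [← Real.exp_nat_mul]
    congr 1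
    push_cast
    ring
  rw [h, ← Real.cos_sq', profile]
  ring

lemma mul_exp_neg_le (y : ℝ) : y * Real.exp (-y) ≤ Real.exp (-1) := by
  have h : y ≤ Real.exp (y - 1) := by linarith [Real.add_one_le_exp (y - 1)]
  calc y * Real.exp (-y) ≤ Real.exp (y - 1) * Real.exp (-y) := by gcongr
    _ = Real.exp (-1) := by rw [← Real.exp_add]; ring_nf

lemma profile_sq_le (ε x : ℝ) {t : ℝ} (ht : 0 ≤ t) :
    profile ε t x ^ 2 ≤ 2 * t * ε ^ 4 * Real.exp (-1) := by
  rw [profile_sq]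
  have h : 0 ≤ 1 - Real.sin x ^ 2 := by linarith [Real.sin_sq_le_one x]
  calc _ ≤ 2 * t * ε ^ 4 * (1 - Real.sin x ^ 2) * Real.exp (-1) := by
        gcongr
        exact mul_exp_neg_le _
    _ ≤ 2 * t * ε ^ 4 * 1 * Real.exp (-1) := by
        gcongr
        linarith [sq_nonneg (Real.sin x)]
    _ = _ := by ring

lemma abs_profile_le (ε x : ℝ) {t : ℝ} (ht : 0 ≤ t) :
    |profile ε t x| ≤ √(2 * t * ε ^ 4 * Real.exp (-1)) :=
  Real.abs_le_sqrt (profile_sq_le ε x ht)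

lemma iSup_abs_profile_sq_le (ε : ℝ) {t : ℝ} (ht : 0 ≤ t) :
    (⨆ x : Set.Icc (-π) π, |profile ε t x|) ^ 2 ≤ 2 * t * ε ^ 4 * Real.exp (-1) := by
  have h0 : 0 ≤ ⨆ x : Set.Icc (-π) π, |profile ε t x| := Real.iSup_nonneg fun _ => abs_nonneg _
  rw [← Real.le_sqrt h0 (by positivity)]
  exact Real.iSup_le (fun x => abs_profile_le ε x ht) (Real.sqrt_nonneg _)

lemma le_iSup_abs_profile_sq {ε t : ℝ} (hε : 0 < ε) (ht : 1 ≤ 2 * ε ^ 2 * t) :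
    2 * t * ε ^ 4 * Real.exp (-1) * (1 - (2 * ε ^ 2 * t)⁻¹) ≤
      (⨆ x : Set.Icc (-π) π, |profile ε t x|) ^ 2 := by
  have ht0 : 0 ≤ t := by
    by_contra! h
    nlinarith [mul_pos (pow_pos hε 2) (neg_pos.2 h)]
  set s : ℝ := √((2 * ε ^ 2 * t)⁻¹) with hs
  have hs2 : s ^ 2 = (2 * ε ^ 2 * t)⁻¹ := Real.sq_sqrt (by positivity)
  have hs1 : s ≤ 1 := Real.sqrt_le_one.2 (inv_le_one_of_one_le₀ ht)
  have hsin : Real.sin (Real.arcsin s) = s :=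
    Real.sin_arcsin (by linarith [Real.sqrt_nonneg (2 * ε ^ 2 * t)⁻¹]) hs1
  have hmem : Real.arcsin s ∈ Set.Icc (-π) π :=
    ⟨by linarith [Real.neg_pi_div_two_le_arcsin s, Real.pi_pos],
      by linarith [Real.arcsin_le_pi_div_two s, Real.pi_pos]⟩
  have hle : |profile ε t (Real.arcsin s)| ≤ ⨆ x : Set.Icc (-π) π, |profile ε t x| :=
    le_ciSup (f := fun x : Set.Icc (-π) π => |profile ε t x|)
      ⟨_, Set.forall_mem_range.2 fun x => abs_profile_le ε x ht0⟩ ⟨_, hmem⟩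
  calc _ = |profile ε t (Real.arcsin s)| ^ 2 := by
        rw [sq_abs, profile_sq, hsin, hs2, mul_inv_cancel₀ (by linarith)]
        ring
    _ ≤ _ := by gcongr

lemma tendsto_iSup_abs_profile_sq {ε : ℝ} (hε : 0 < ε) :
    Tendsto (fun t : ℝ => (⨆ x : Set.Icc (-π) π, |profile ε t x|) ^ 2 /
      (2 * t * ε ^ 4 * Real.exp (-1))) atTop (nhds 1) := by
  have hlin : Tendsto (fun t : ℝ => 2 * ε ^ 2 * t) atTop atTop :=
    tendsto_id.const_mul_atTop (by positivity)
  have hlow : Tendsto (fun t : ℝ => 1 - (2 * ε ^ 2 * t)⁻¹) atTop (nhds 1) := by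
    simpa using (tendsto_inv_atTop_zero.comp hlin).const_sub 1
  refine tendsto_of_tendsto_of_tendsto_of_le_of_le' hlow tendsto_const_nhds ?_ ?_
  · filter_upwards [eventually_gt_atTop 0, hlin.eventually_ge_atTop 1] with t ht h1
    rw [le_div_iff₀ (by positivity), mul_comm]
    exact le_iSup_abs_profile_sq hε h1
  · filter_upwards [eventually_gt_atTop 0] with t ht
    exact div_le_one_of_le₀ (iSup_abs_profile_sq_le ε ht.le) (by positivity)

lemma integral_iSup_sq (ε t : ℝ) :
    ∫ x₁ in (-π)..π, (⨆ x₂ : Set.Icc (-π) π,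
        |2 * t * ε ^ 3 * Real.sin (x₂ : ℝ) * Real.cos (x₂ : ℝ) * Real.cos x₁ *
          Real.exp (-(ε ^ 2) * Real.sin (x₂ : ℝ) ^ 2 * t)|) ^ 2 =
      π * (⨆ x : Set.Icc (-π) π, |profile ε t x|) ^ 2 := by
  have h (x₁ : ℝ) : (⨆ x₂ : Set.Icc (-π) π,
        |2 * t * ε ^ 3 * Real.sin (x₂ : ℝ) * Real.cos (x₂ : ℝ) * Real.cos x₁ *
          Real.exp (-(ε ^ 2) * Real.sin (x₂ : ℝ) ^ 2 * t)|) ^ 2 =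
      Real.cos x₁ ^ 2 * (⨆ x : Set.Icc (-π) π, |profile ε t x|) ^ 2 := by
    rw [← sq_abs (Real.cos x₁), ← mul_pow, Real.mul_iSup_of_nonneg (abs_nonneg _)]
    congr 2
    ext x
    rw [← abs_mul, profile]
    ring_nf
  simp_rw [h]
  rw [intervalIntegral.integral_mul_const, integral_cos_sq]
  simp

/-- For every `ε > 0`, with `F(x₁,x₂,t) = 2 t ε³ sin x₂ cos x₂ cos x₁ exp(−ε² sin²x₂ t)`,
the mixed `L²_{x₁}L^∞_{x₂}` norm of `F(·,·,t)` over `[−π,π]²` divided by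
`(2π/e)^{1/2} ε² t^{1/2}` tends to `1` as `t → ∞`. -/
theorem stmt_1 (ε : ℝ) (hε : 0 < ε) :
    Tendsto (fun t : ℝ =>
      (∫ x₁ in (-π)..π,
          (⨆ x₂ : Set.Icc (-π) π,
            |2 * t * ε ^ 3 * Real.sin (x₂ : ℝ) * Real.cos (x₂ : ℝ) * Real.cos x₁ *
              Real.exp (-(ε ^ 2) * Real.sin (x₂ : ℝ) ^ 2 * t)|) ^ 2) ^ ((1 : ℝ) / 2) /
        ((2 * π / Real.exp 1) ^ ((1 : ℝ) / 2) * ε ^ 2 * t ^ ((1 : ℝ) / 2)))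
      atTop (nhds 1) := by
  have hlim := (tendsto_iSup_abs_profile_sq hε).rpow_const (p := 1 / 2) (.inl one_ne_zero)
  rw [Real.one_rpow] at hlim
  refine hlim.congr' ?_
  filter_upwards [eventually_gt_atTop 0] with t ht
  have hε2 : ε ^ 2 = (ε ^ 4) ^ ((1 : ℝ) / 2) := by
    rw [← Real.sqrt_eq_rpow, show ε ^ 4 = (ε ^ 2) ^ 2 by ring, Real.sqrt_sq (by positivity)]
  rw [integral_iSup_sq, hε2, ← Real.mul_rpow (by positivity) (by positivity),
    ← Real.mul_rpow (by positivity) ht.le,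
    ← Real.div_rpow (by positivity) (by positivity), Real.exp_neg]
  congr 1
  field_simp
end

section
/- Let v(x₁,x₂) := (−sin x₁ cos x₂, cos x₁ sin x₂) and let g : ℝ² × [0,∞) → ℝ be smooth (C^∞) and satisfy, for all (x₁,x₂,t), the equation ∂_t g = sin²x₁ cos²x₂ ∂₁²g + cos²x₁ sin²x₂ ∂₂²g − (1/2) sin(2x₁) sin(2x₂) ∂₁∂₂g + (1/2) sin(2x₁) ∂₁g + (1/2) sin(2x₂) ∂₂g. Then for all t ≥ 0 one has ∂₁g(0,0,t) = e^t ∂₁g(0,0,0) and ∂₂g(0,0,t) = e^t ∂₂g(0,0,0). Consequently, for the magnetic field B(x,t) := (v₁(x₁,x₂), v₂(x₁,x₂), g(x₁,x₂,t)), one has sup_x |∇B(x,t)| ≥ e^t · |(∂₁g(0,0,0), ∂₂g(0,0,0))| for all t ≥ 0. -/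
open Real Filter MeasureTheory ENNReal

open scoped ContDiff

/-- The mixed partial derivatives of a smooth function of two variables agree. -/
theorem hasDerivAt_deriv_fst_of_contDiff {F : ℝ × ℝ → ℝ} (hF : ContDiff ℝ ∞ F) (x t : ℝ) :
    HasDerivAt (fun s => deriv (fun y => F (y, s)) x)
      (deriv (fun y => deriv (fun s => F (y, s)) t) x) t := by
  have hd (p : ℝ × ℝ) : HasFDerivAt F (fderiv ℝ F p) p :=
    (hF.differentiable (by simp) p).hasFDerivAt
  have hfst (y s : ℝ) : HasDerivAt (fun z : ℝ => (z, s)) ((1 : ℝ), (0 : ℝ)) y :=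
    (hasDerivAt_id y).prodMk (hasDerivAt_const y s)
  have hsnd (y s : ℝ) : HasDerivAt (fun z : ℝ => (y, z)) ((0 : ℝ), (1 : ℝ)) s :=
    (hasDerivAt_const s y).prodMk (hasDerivAt_id s)
  have hx (y s : ℝ) : deriv (fun z => F (z, s)) y = fderiv ℝ F (y, s) (1, 0) :=
    ((hd (y, s)).comp_hasDerivAt y (hfst y s)).deriv
  have ht (y s : ℝ) : deriv (fun z => F (y, z)) s = fderiv ℝ F (y, s) (0, 1) :=
    ((hd (y, s)).comp_hasDerivAt s (hsnd y s)).deriv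
  have hdd : HasFDerivAt (fderiv ℝ F) (fderiv ℝ (fderiv ℝ F) (x, t)) (x, t) :=
    ((hF.fderiv_right (m := ∞) (by simp)).differentiable (by simp) _).hasFDerivAt
  have hsymm : IsSymmSndFDerivAt ℝ F (x, t) :=
    hF.contDiffAt.isSymmSndFDerivAt
      (by simpa using WithTop.coe_le_coe.2 (le_top : (2 : ℕ∞) ≤ ⊤))
  simp only [hx, ht]
  have h1 : HasDerivAt (fun s => fderiv ℝ F (x, s) (1, 0))
      (fderiv ℝ (fderiv ℝ F) (x, t) (0, 1) (1, 0)) t :=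
    (ContinuousLinearMap.apply ℝ ℝ ((1 : ℝ), (0 : ℝ))).hasFDerivAt.comp_hasDerivAt t
      (hdd.comp_hasDerivAt t (hsnd x t))
  have h2 : HasDerivAt (fun y => fderiv ℝ F (y, t) (0, 1))
      (fderiv ℝ (fderiv ℝ F) (x, t) (1, 0) (0, 1)) x :=
    (ContinuousLinearMap.apply ℝ ℝ ((0 : ℝ), (1 : ℝ))).hasFDerivAt.comp_hasDerivAt x
      (hdd.comp_hasDerivAt x (hfst x t))
  rw [h2.deriv, hsymm.eq]
  exact h1

/-- A function equal to its own derivative on `[0, ∞)` is `exp t * y 0`. -/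
theorem eq_exp_mul_of_hasDerivAt_self {y : ℝ → ℝ} (hy : ∀ t, 0 ≤ t → HasDerivAt y (y t) t)
    {t : ℝ} (ht : 0 ≤ t) : y t = Real.exp t * y 0 := by
  have hd (s : ℝ) (hs : 0 ≤ s) : HasDerivAt (fun r => Real.exp (-r) * y r) 0 s := by
    refine (((hasDerivAt_neg s).exp).mul (hy s hs)).congr_deriv ?_
    ring
  have h := constant_of_has_deriv_right_zero (a := 0) (b := t)
    (fun s hs => (hd s hs.1).continuousAt.continuousWithinAt)
    (fun s hs => (hd s hs.1).hasDerivWithinAt) t ⟨ht, le_rfl⟩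
  simp only [neg_zero, Real.exp_zero, one_mul] at h
  rw [← h, ← mul_assoc, ← Real.exp_add]
  simp

/-- Exponential growth at the stagnation point for the one-dimensional degenerate diffusion
equation `∂ₜ f = sin² x ∂ₓ² f + (1/2) sin (2x) ∂ₓ f`. -/
theorem deriv_zero_eq_exp_mul_of_sin_diffusion {f : ℝ → ℝ → ℝ}
    (hf : ContDiff ℝ ∞ (fun p : ℝ × ℝ => f p.1 p.2))
    (heq : ∀ x t : ℝ, 0 ≤ t → deriv (fun s => f x s) t =
      Real.sin x ^ 2 * deriv (deriv (fun y => f y t)) x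
        + (1 / 2) * Real.sin (2 * x) * deriv (fun y => f y t) x)
    {t : ℝ} (ht : 0 ≤ t) :
    deriv (fun y => f y t) 0 = Real.exp t * deriv (fun y => f y 0) 0 := by
  refine eq_exp_mul_of_hasDerivAt_self (y := fun t => deriv (fun y => f y t) 0) (fun t ht => ?_) ht
  convert hasDerivAt_deriv_fst_of_contDiff hf 0 t using 1
  have hslice : ContDiff ℝ ∞ (fun y => f y t) := hf.comp (contDiff_id.prodMk contDiff_const)
  have h1 : ContDiff ℝ ∞ (deriv (fun y => f y t)) := (contDiff_infty_iff_deriv.1 hslice).2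
  have h2 : ContDiff ℝ ∞ (deriv (deriv (fun y => f y t))) := (contDiff_infty_iff_deriv.1 h1).2
  have hd1 := (h1.differentiable (by simp) 0).hasDerivAt
  have hd2 := (h2.differentiable (by simp) 0).hasDerivAt
  have hs := (Real.hasDerivAt_sin 0).pow 2
  have hs2 := (((hasDerivAt_id (0 : ℝ)).const_mul 2).sin).const_mul (1 / 2)
  have h := (hs.mul hd2).add (hs2.mul hd1)
  simp only [heq _ t ht]
  refine (Eq.trans (HasDerivAt.deriv h) ?_).symm
  simp

/-- For the cellular flow `v = (−sin x₁ cos x₂, cos x₁ sin x₂)`, any smooth solution `g`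
of the rank-one diffusion equation `∂ₜ g = (v·∇)² g` (written out explicitly) satisfies
`∂₁g(0,0,t) = eᵗ ∂₁g(0,0,0)` and `∂₂g(0,0,t) = eᵗ ∂₂g(0,0,0)` for `t ≥ 0`; consequently
the supremum of the Frobenius norm of the spatial gradient of `B = (v₁, v₂, g)` is at
least `eᵗ |(∂₁g(0,0,0), ∂₂g(0,0,0))|`. -/
theorem stmt_3 (g : ℝ → ℝ → ℝ → ℝ)
    (hg : ContDiff ℝ (⊤ : ℕ∞) (fun q : ℝ × ℝ × ℝ => g q.1 q.2.1 q.2.2))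
    (heq : ∀ x₁ x₂ t : ℝ, 0 ≤ t →
      deriv (fun s => g x₁ x₂ s) t =
        Real.sin x₁ ^ 2 * Real.cos x₂ ^ 2 * deriv (deriv (fun y => g y x₂ t)) x₁
        + Real.cos x₁ ^ 2 * Real.sin x₂ ^ 2 * deriv (deriv (fun y => g x₁ y t)) x₂
        - (1 / 2) * Real.sin (2 * x₁) * Real.sin (2 * x₂) *
            deriv (fun y₁ => deriv (fun y₂ => g y₁ y₂ t) x₂) x₁
        + (1 / 2) * Real.sin (2 * x₁) * deriv (fun y => g y x₂ t) x₁
        + (1 / 2) * Real.sin (2 * x₂) * deriv (fun y => g x₁ y t) x₂) :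
    ∀ t : ℝ, 0 ≤ t →
      deriv (fun y => g y 0 t) 0 = Real.exp t * deriv (fun y => g y 0 0) 0 ∧
      deriv (fun y => g 0 y t) 0 = Real.exp t * deriv (fun y => g 0 y 0) 0 ∧
      ENNReal.ofReal (Real.exp t *
          Real.sqrt ((deriv (fun y => g y 0 0) 0) ^ 2 + (deriv (fun y => g 0 y 0) 0) ^ 2))
        ≤ ⨆ x : ℝ × ℝ, ENNReal.ofReal (Real.sqrt (
            (deriv (fun y => -Real.sin y * Real.cos x.2) x.1) ^ 2 +
            (deriv (fun y => -Real.sin x.1 * Real.cos y) x.2) ^ 2 +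
            (deriv (fun y => Real.cos y * Real.sin x.2) x.1) ^ 2 +
            (deriv (fun y => Real.cos x.1 * Real.sin y) x.2) ^ 2 +
            (deriv (fun y => g y x.2 t) x.1) ^ 2 +
            (deriv (fun y => g x.1 y t) x.2) ^ 2)) := by
  intro t ht
  have e1 : deriv (fun y => g y 0 t) 0 = Real.exp t * deriv (fun y => g y 0 0) 0 :=
    deriv_zero_eq_exp_mul_of_sin_diffusion (f := fun x t => g x 0 t)
      (hg.comp (contDiff_fst.prodMk (contDiff_const.prodMk contDiff_snd)))
      (fun x s hs => by simpa using heq x 0 s hs) ht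
  have e2 : deriv (fun y => g 0 y t) 0 = Real.exp t * deriv (fun y => g 0 y 0) 0 :=
    deriv_zero_eq_exp_mul_of_sin_diffusion (f := fun x t => g 0 x t)
      (hg.comp (contDiff_const.prodMk (contDiff_fst.prodMk contDiff_snd)))
      (fun x s hs => by simpa using heq 0 x s hs) ht
  refine ⟨e1, e2, le_iSup_of_le ((0 : ℝ), (0 : ℝ)) (ENNReal.ofReal_le_ofReal ?_)⟩
  refine Real.le_sqrt_of_sq_le ?_
  rw [mul_pow, Real.sq_sqrt (by positivity), e1, e2, mul_pow, mul_pow, mul_add, add_assoc _ (_ * _)]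
  exact le_add_of_nonneg_left (by positivity)
end

section
/- Let b, v : ℝ² × [0,∞) → ℝ² and p : ℝ² × [0,∞) → ℝ be smooth (C^∞) and 2π-periodic in each spatial variable, with div b = div v = 0, v = (b·∇)b + ∇p, and ∂_t b + (u·∇)b = (b·∇)u + ∂₁u where u := ∂₁b + v. Assume P₀b(·,0) = 0, i.e. ∫_{−π}^{π} b(x₁,x₂,0) dx₁ = 0 for every x₂. Then: (i) P₀b₂(x₂,t) = 0 for all x₂ and all t ≥ 0; and (ii) setting a(x₂,t) := P₀b₁(x₂,t), f := b − P₀b, and w := v − P₀v, the function a satisfies ∂_t a(x₂,t) = ∂₂ [ (1/2π) ∫_{−π}^{π} ( 2 f₂ ∂₁f₁ + f₂ w₁ − w₂ f₁ )(x₁,x₂,t) dx₁ ]. In particular a does not appear on the right-hand side. -/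
open Real Filter MeasureTheory

/-- Joint smoothness of a curried function of two real variables. -/
abbrev SmoothPlane (G : ℝ → ℝ → ℝ) : Prop :=
  ContDiff ℝ (⊤ : ℕ∞) (fun q : ℝ × ℝ => G q.1 q.2)

/-- Partial derivative in the first variable. -/
noncomputable abbrev partialFst (G : ℝ → ℝ → ℝ) (x y : ℝ) : ℝ := deriv (fun z => G z y) x

/-- Partial derivative in the second variable. -/
noncomputable abbrev partialSnd (G : ℝ → ℝ → ℝ) (x y : ℝ) : ℝ := deriv (fun z => G x z) y

namespace SmoothPlane

variable {G : ℝ → ℝ → ℝ}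

theorem hasDerivAt_fst_fderiv (hG : SmoothPlane G) (x y : ℝ) :
    HasDerivAt (fun z => G z y) (fderiv ℝ (fun q : ℝ × ℝ => G q.1 q.2) (x, y) (1, 0)) x :=
  ((hG.differentiable (by simp)) (x, y)).hasFDerivAt.comp_hasDerivAt (f := fun z => (z, y)) x
    ((hasDerivAt_id x).prodMk (hasDerivAt_const x y))

theorem hasDerivAt_snd_fderiv (hG : SmoothPlane G) (x y : ℝ) :
    HasDerivAt (fun z => G x z) (fderiv ℝ (fun q : ℝ × ℝ => G q.1 q.2) (x, y) (0, 1)) y :=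
  ((hG.differentiable (by simp)) (x, y)).hasFDerivAt.comp_hasDerivAt y
    ((hasDerivAt_const y x).prodMk (hasDerivAt_id y))

theorem hasDerivAt_fst (hG : SmoothPlane G) (x y : ℝ) :
    HasDerivAt (fun z => G z y) (partialFst G x y) x :=
  (hG.hasDerivAt_fst_fderiv x y).differentiableAt.hasDerivAt

theorem hasDerivAt_snd (hG : SmoothPlane G) (x y : ℝ) :
    HasDerivAt (fun z => G x z) (partialSnd G x y) y :=
  (hG.hasDerivAt_snd_fderiv x y).differentiableAt.hasDerivAt

theorem partialFst_eq (hG : SmoothPlane G) (x y : ℝ) :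
    partialFst G x y = fderiv ℝ (fun q : ℝ × ℝ => G q.1 q.2) (x, y) (1, 0) :=
  (hG.hasDerivAt_fst_fderiv x y).deriv

theorem partialSnd_eq (hG : SmoothPlane G) (x y : ℝ) :
    partialSnd G x y = fderiv ℝ (fun q : ℝ × ℝ => G q.1 q.2) (x, y) (0, 1) :=
  (hG.hasDerivAt_snd_fderiv x y).deriv

theorem contDiff_fderiv (hG : SmoothPlane G) :
    ContDiff ℝ (⊤ : ℕ∞) (fderiv ℝ (fun q : ℝ × ℝ => G q.1 q.2)) :=
  hG.fderiv_right (by simp)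

protected theorem partialFst (hG : SmoothPlane G) : SmoothPlane (partialFst G) := by
  have h : (fun q : ℝ × ℝ => partialFst G q.1 q.2) =
      fun q => fderiv ℝ (fun q : ℝ × ℝ => G q.1 q.2) q (1, 0) :=
    funext fun q => hG.partialFst_eq q.1 q.2
  rw [SmoothPlane, h]
  exact hG.contDiff_fderiv.clm_apply contDiff_const

protected theorem partialSnd (hG : SmoothPlane G) : SmoothPlane (partialSnd G) := by
  have h : (fun q : ℝ × ℝ => partialSnd G q.1 q.2) =
      fun q => fderiv ℝ (fun q : ℝ × ℝ => G q.1 q.2) q (0, 1) :=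
    funext fun q => hG.partialSnd_eq q.1 q.2
  rw [SmoothPlane, h]
  exact hG.contDiff_fderiv.clm_apply contDiff_const

theorem partialSnd_partialFst (hG : SmoothPlane G) (x y : ℝ) :
    partialSnd (partialFst G) x y = partialFst (partialSnd G) x y := by
  have hd := (hG.contDiff_fderiv.differentiable (by simp)) (x, y)
  have h₁ : partialFst G = fun x y => fderiv ℝ (fun q : ℝ × ℝ => G q.1 q.2) (x, y) (1, 0) :=
    funext fun x => funext fun y => hG.partialFst_eq x y
  have h₂ : partialSnd G = fun x y => fderiv ℝ (fun q : ℝ × ℝ => G q.1 q.2) (x, y) (0, 1) :=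
    funext fun x => funext fun y => hG.partialSnd_eq x y
  rw [hG.partialFst.partialSnd_eq, hG.partialSnd.partialFst_eq, h₁, h₂]
  rw [fderiv_clm_apply hd (differentiableAt_const _), fderiv_clm_apply hd (differentiableAt_const _)]
  simpa using (hG.contDiffAt (x := (x, y))).isSymmSndFDerivAt
    (by simpa using
      (WithTop.coe_le_coe.2 le_top : ((2 : ℕ∞) : WithTop ℕ∞) ≤ ((⊤ : ℕ∞) : WithTop ℕ∞)))
    (0, 1) (1, 0)

theorem continuous_fst (hG : SmoothPlane G) (y : ℝ) : Continuous fun x => G x y :=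
  hG.continuous.comp (by fun_prop : Continuous fun x : ℝ => (x, y))

/-- Differentiation under the integral sign over a compact interval. -/
theorem hasDerivAt_integral (hG : SmoothPlane G) (a b y : ℝ) :
    HasDerivAt (fun z => ∫ x in a..b, G x z) (∫ x in a..b, partialSnd G x y) y := by
  have hc := hG.partialSnd.continuous
  obtain ⟨C, hC⟩ := (isCompact_uIcc.prod isCompact_Icc).exists_bound_of_continuousOn
    (s := Set.uIcc a b ×ˢ Set.Icc (y - 1) (y + 1)) hc.continuousOn
  refine (intervalIntegral.hasDerivAt_integral_of_dominated_loc_of_deriv_le (μ := volume)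
    (F := fun z x => G x z) (F' := fun z x => partialSnd G x z) (bound := fun _ => C)
    (Icc_mem_nhds (by linarith : y - 1 < y) (by linarith : y < y + 1))
    (Eventually.of_forall fun z => (hG.continuous_fst z).aestronglyMeasurable)
    ((hG.continuous_fst y).intervalIntegrable _ _)
    (hG.partialSnd.continuous_fst y).aestronglyMeasurable
    (Eventually.of_forall fun x hx z hz => hC (x, z) ⟨Set.uIoc_subset_uIcc hx, hz⟩)
    (by simp) (Eventually.of_forall fun x _ z _ => hG.hasDerivAt_snd x z)).2

theorem integral_partialFst_eq_zero (hG : SmoothPlane G)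
    (hper : ∀ x y, G (x + 2 * π) y = G x y) (y : ℝ) :
    ∫ x in (-π)..π, partialFst G x y = 0 := by
  rw [intervalIntegral.integral_eq_sub_of_hasDerivAt (fun x _ => hG.hasDerivAt_fst x y)
    ((hG.partialFst.continuous_fst y).intervalIntegrable _ _), ← hper (-π) y]
  ring_nf

end SmoothPlane

theorem deriv_add_period {g : ℝ → ℝ} {c : ℝ} (h : ∀ x, g (x + c) = g x) (x : ℝ) :
    deriv g (x + c) = deriv g x := by
  rw [← deriv_comp_add_const]
  simp_rw [h]

section PlanarFields

variable {B₁ B₂ U₁ U₂ V₁ V₂ P : ℝ → ℝ → ℝ}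

/-- If `B` and `V` are divergence free, then so is `∂₁B + V`. -/
theorem divergence_partialFst_add_eq_zero (hB₁ : SmoothPlane B₁) (hB₂ : SmoothPlane B₂)
    (hV₁ : SmoothPlane V₁) (hV₂ : SmoothPlane V₂)
    (hB : ∀ x y, partialFst B₁ x y + partialSnd B₂ x y = 0)
    (hV : ∀ x y, partialFst V₁ x y + partialSnd V₂ x y = 0) (x y : ℝ) :
    partialFst (fun x y => partialFst B₁ x y + V₁ x y) x y +
      partialSnd (fun x y => partialFst B₂ x y + V₂ x y) x y = 0 := by
  have h₁ := ((hB₁.partialFst.hasDerivAt_fst x y).add (hV₁.hasDerivAt_fst x y)).deriv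
  have h₂ := ((hB₂.partialFst.hasDerivAt_snd x y).add (hV₂.hasDerivAt_snd x y)).deriv
  have h₃ := ((hB₁.partialFst.hasDerivAt_fst x y).add (hB₂.partialSnd.hasDerivAt_fst x y)).deriv
  have h₄ : ((fun z => partialFst B₁ z y) + fun z => partialSnd B₂ z y) = fun _ => 0 :=
    funext fun z => hB z y
  rw [h₄, deriv_const] at h₃
  have h₅ := hB₂.partialSnd_partialFst x y
  have h₆ := hV x y
  refine (congrArg₂ (· + ·) h₁ h₂).trans ?_
  linarith

/-- The first component of the ideal induction term of divergence-free fields is a pure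
`∂₂`-derivative. -/
theorem induction_fst (hB₁ : SmoothPlane B₁) (hB₂ : SmoothPlane B₂)
    (hU₁ : SmoothPlane U₁) (hU₂ : SmoothPlane U₂)
    (hB : ∀ x y, partialFst B₁ x y + partialSnd B₂ x y = 0)
    (hU : ∀ x y, partialFst U₁ x y + partialSnd U₂ x y = 0) (x y : ℝ) :
    partialSnd (fun x y => B₂ x y * U₁ x y - U₂ x y * B₁ x y) x y =
      B₁ x y * partialFst U₁ x y + B₂ x y * partialSnd U₁ x y -
        U₁ x y * partialFst B₁ x y - U₂ x y * partialSnd B₁ x y := by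
  have h := (((hB₂.hasDerivAt_snd x y).mul (hU₁.hasDerivAt_snd x y)).sub
    ((hU₂.hasDerivAt_snd x y).mul (hB₁.hasDerivAt_snd x y))).deriv
  refine h.trans ?_
  linear_combination U₁ x y * hB x y - B₁ x y * hU x y

/-- The second component of the ideal induction term of divergence-free fields is a pure
`∂₁`-derivative. -/
theorem induction_snd (hB₁ : SmoothPlane B₁) (hB₂ : SmoothPlane B₂)
    (hU₁ : SmoothPlane U₁) (hU₂ : SmoothPlane U₂)
    (hB : ∀ x y, partialFst B₁ x y + partialSnd B₂ x y = 0)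
    (hU : ∀ x y, partialFst U₁ x y + partialSnd U₂ x y = 0) (x y : ℝ) :
    partialFst (fun x y => B₁ x y * U₂ x y - U₁ x y * B₂ x y) x y =
      B₁ x y * partialFst U₂ x y + B₂ x y * partialSnd U₂ x y -
        U₁ x y * partialFst B₂ x y - U₂ x y * partialSnd B₂ x y := by
  have h := (((hB₁.hasDerivAt_fst x y).mul (hU₂.hasDerivAt_fst x y)).sub
    ((hU₁.hasDerivAt_fst x y).mul (hB₂.hasDerivAt_fst x y))).deriv
  refine h.trans ?_
  linear_combination U₂ x y * hB x y - B₂ x y * hU x y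

/-- The `x₁`-average of `V₂` vanishes when `V` is divergence free and `V₂` is the second component
of `(B·∇)B + ∇P`. -/
theorem integral_snd_velocity_eq_zero (hB₁ : SmoothPlane B₁) (hB₂ : SmoothPlane B₂)
    (hV₁ : SmoothPlane V₁) (hV₂ : SmoothPlane V₂) (hP : SmoothPlane P)
    (pB₁ : ∀ x y, B₁ (x + 2 * π) y = B₁ x y) (pB₂ : ∀ x y, B₂ (x + 2 * π) y = B₂ x y)
    (pV₁ : ∀ x y, V₁ (x + 2 * π) y = V₁ x y)
    (pB₂' : ∀ x y, B₂ x (y + 2 * π) = B₂ x y) (pP' : ∀ x y, P x (y + 2 * π) = P x y)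
    (hB : ∀ x y, partialFst B₁ x y + partialSnd B₂ x y = 0)
    (hV : ∀ x y, partialFst V₁ x y + partialSnd V₂ x y = 0)
    (hVB : ∀ x y, V₂ x y =
      B₁ x y * partialFst B₂ x y + B₂ x y * partialSnd B₂ x y + partialSnd P x y) (y : ℝ) :
    ∫ x in (-π)..π, V₂ x y = 0 := by
  have hM (y : ℝ) : HasDerivAt (fun y => ∫ x in (-π)..π, V₂ x y) 0 y := by
    have h := hV₂.hasDerivAt_integral (-π) π y
    have e : (fun x => partialSnd V₂ x y) = fun x => -partialFst V₁ x y :=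
      funext fun x => by linarith [hV x y]
    rwa [e, intervalIntegral.integral_neg, hV₁.integral_partialFst_eq_zero pV₁, neg_zero] at h
  have hconst (z : ℝ) : ∫ x in (-π)..π, V₂ x z = ∫ x in (-π)..π, V₂ x y :=
    is_const_of_deriv_eq_zero (fun y => (hM y).differentiableAt) (fun y => (hM y).deriv) z y
  have hQ : SmoothPlane fun x y => B₂ x y * B₂ x y + P x y := (hB₂.mul hB₂).add hP
  have hR : SmoothPlane fun x y => B₁ x y * B₂ x y := hB₁.mul hB₂
  have hN (z : ℝ) : HasDerivAt (fun z => ∫ x in (-π)..π, (B₂ x z * B₂ x z + P x z))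
      (∫ x in (-π)..π, V₂ x y) z := by
    convert hQ.hasDerivAt_integral (-π) π z using 1
    have e : (fun x => V₂ x z) = fun x => partialFst (fun x y => B₁ x y * B₂ x y) x z +
        partialSnd (fun x y => B₂ x y * B₂ x y + P x y) x z := by
      funext x
      have h₁ := ((hB₁.hasDerivAt_fst x z).mul (hB₂.hasDerivAt_fst x z)).deriv
      have h₂ := (((hB₂.hasDerivAt_snd x z).mul (hB₂.hasDerivAt_snd x z)).add
        (hP.hasDerivAt_snd x z)).deriv
      refine Eq.trans ?_ (congrArg₂ (· + ·) h₁ h₂).symm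
      linear_combination hVB x z - B₂ x z * hB x z
    rw [← hconst z, e, intervalIntegral.integral_add
      ((hR.partialFst.continuous_fst z).intervalIntegrable _ _)
      ((hQ.partialSnd.continuous_fst z).intervalIntegrable _ _),
      hR.integral_partialFst_eq_zero (fun x y => by rw [pB₁, pB₂]), zero_add]
  have h := intervalIntegral.integral_eq_sub_of_hasDerivAt (a := 0) (b := 0 + 2 * π)
    (fun z _ => hN z) (by simp)
  simp only [pB₂', pP', sub_self, intervalIntegral.integral_const, smul_eq_mul] at h
  exact (mul_eq_zero.mp h).resolve_left (by simp [pi_ne_zero])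

end PlanarFields

/-- The mean flux only sees the fluctuations `β₁ - A` and `ν₁ - c` when `β₂` and `ν₂` have
vanishing mean. -/
theorem integral_flux_eq {β₁ β₂ ν₁ ν₂ β₁' β₂' : ℝ → ℝ} (A c : ℝ)
    (hβ₁ : ∀ x, HasDerivAt β₁ (β₁' x) x) (hβ₂ : ∀ x, HasDerivAt β₂ (β₂' x) x)
    (cβ₁' : Continuous β₁') (cβ₂' : Continuous β₂') (cν₁ : Continuous ν₁) (cν₂ : Continuous ν₂)
    (pβ₁ : ∀ x, β₁ (x + 2 * π) = β₁ x) (pβ₂ : ∀ x, β₂ (x + 2 * π) = β₂ x)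
    (mβ₂ : ∫ x in (-π)..π, β₂ x = 0) (mν₂ : ∫ x in (-π)..π, ν₂ x = 0) :
    ∫ x in (-π)..π, (β₂ x * (β₁' x + ν₁ x) - (β₂' x + ν₂ x) * β₁ x) =
      ∫ x in (-π)..π, (2 * β₂ x * β₁' x + β₂ x * (ν₁ x - c) - ν₂ x * (β₁ x - A)) := by
  have cβ₁ : Continuous β₁ := continuous_iff_continuousAt.2 fun x => (hβ₁ x).continuousAt
  have cβ₂ : Continuous β₂ := continuous_iff_continuousAt.2 fun x => (hβ₂ x).continuousAt
  have hprod : ∫ x in (-π)..π, (β₂' x * β₁ x + β₂ x * β₁' x) = 0 := by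
    rw [intervalIntegral.integral_eq_sub_of_hasDerivAt (fun x _ => (hβ₂ x).mul (hβ₁ x))
      (Continuous.intervalIntegrable (by fun_prop) _ _)]
    have h₁ := pβ₁ (-π)
    have h₂ := pβ₂ (-π)
    rw [show -π + 2 * π = π by ring] at h₁ h₂
    simp [h₁, h₂]
  rw [← sub_eq_zero, ← intervalIntegral.integral_sub
    (Continuous.intervalIntegrable (by fun_prop) _ _)
    (Continuous.intervalIntegrable (by fun_prop) _ _)]
  have e : (fun x => β₂ x * (β₁' x + ν₁ x) - (β₂' x + ν₂ x) * β₁ x -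
      (2 * β₂ x * β₁' x + β₂ x * (ν₁ x - c) - ν₂ x * (β₁ x - A))) =
      fun x => c * β₂ x - A * ν₂ x - (β₂' x * β₁ x + β₂ x * β₁' x) := by
    funext x; ring
  rw [e, intervalIntegral.integral_sub (Continuous.intervalIntegrable (by fun_prop) _ _)
    (Continuous.intervalIntegrable (by fun_prop) _ _), intervalIntegral.integral_sub
    (Continuous.intervalIntegrable (by fun_prop) _ _)
    (Continuous.intervalIntegrable (by fun_prop) _ _), intervalIntegral.integral_const_mul,
    intervalIntegral.integral_const_mul, mβ₂, mν₂, hprod]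
  simp

/-- For the two-dimensional magnetic-relaxation perturbation system (γ = 0) around
`B = e₁`: if `b, v, p` are smooth, `2π`-periodic in each spatial variable, divergence
free (for `b` and `v`), `v = (b·∇)b + ∇p`, and `b` evolves by
`∂ₜ b + (u·∇)b = (b·∇)u + ∂₁u` with `u = ∂₁b + v`, and if the `x₁`-average of `b(·,·,0)`
vanishes, then (i) the `x₁`-average of `b₂` vanishes for all times, and (ii) the
`x₁`-average `a` of `b₁` satisfies `∂ₜ a = ∂₂ P₀(2 f₂ ∂₁f₁ + f₂ w₁ − w₂ f₁)` where
`f = b − P₀b` and `w = v − P₀v`. -/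
theorem stmt_4 (b₁ b₂ v₁ v₂ p u₁ u₂ : ℝ → ℝ → ℝ → ℝ)
    (hb₁ : ContDiff ℝ (⊤ : ℕ∞) (fun q : ℝ × ℝ × ℝ => b₁ q.1 q.2.1 q.2.2))
    (hb₂ : ContDiff ℝ (⊤ : ℕ∞) (fun q : ℝ × ℝ × ℝ => b₂ q.1 q.2.1 q.2.2))
    (hv₁ : ContDiff ℝ (⊤ : ℕ∞) (fun q : ℝ × ℝ × ℝ => v₁ q.1 q.2.1 q.2.2))
    (hv₂ : ContDiff ℝ (⊤ : ℕ∞) (fun q : ℝ × ℝ × ℝ => v₂ q.1 q.2.1 q.2.2))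
    (hp : ContDiff ℝ (⊤ : ℕ∞) (fun q : ℝ × ℝ × ℝ => p q.1 q.2.1 q.2.2))
    (hper : ∀ ψ ∈ [b₁, b₂, v₁, v₂, p], ∀ x₁ x₂ t : ℝ,
      ψ (x₁ + 2 * π) x₂ t = ψ x₁ x₂ t ∧ ψ x₁ (x₂ + 2 * π) t = ψ x₁ x₂ t)
    (hdivb : ∀ x₁ x₂ t : ℝ, 0 ≤ t →
      deriv (fun y => b₁ y x₂ t) x₁ + deriv (fun y => b₂ x₁ y t) x₂ = 0)
    (hdivv : ∀ x₁ x₂ t : ℝ, 0 ≤ t →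
      deriv (fun y => v₁ y x₂ t) x₁ + deriv (fun y => v₂ x₁ y t) x₂ = 0)
    (hv : ∀ x₁ x₂ t : ℝ, 0 ≤ t →
      v₁ x₁ x₂ t = b₁ x₁ x₂ t * deriv (fun y => b₁ y x₂ t) x₁
          + b₂ x₁ x₂ t * deriv (fun y => b₁ x₁ y t) x₂ + deriv (fun y => p y x₂ t) x₁ ∧
      v₂ x₁ x₂ t = b₁ x₁ x₂ t * deriv (fun y => b₂ y x₂ t) x₁
          + b₂ x₁ x₂ t * deriv (fun y => b₂ x₁ y t) x₂ + deriv (fun y => p x₁ y t) x₂)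
    (hu : ∀ x₁ x₂ t : ℝ,
      u₁ x₁ x₂ t = deriv (fun y => b₁ y x₂ t) x₁ + v₁ x₁ x₂ t ∧
      u₂ x₁ x₂ t = deriv (fun y => b₂ y x₂ t) x₁ + v₂ x₁ x₂ t)
    (hevol : ∀ x₁ x₂ t : ℝ, 0 ≤ t →
      (deriv (fun s => b₁ x₁ x₂ s) t
          + u₁ x₁ x₂ t * deriv (fun y => b₁ y x₂ t) x₁
          + u₂ x₁ x₂ t * deriv (fun y => b₁ x₁ y t) x₂
        = b₁ x₁ x₂ t * deriv (fun y => u₁ y x₂ t) x₁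
          + b₂ x₁ x₂ t * deriv (fun y => u₁ x₁ y t) x₂
          + deriv (fun y => u₁ y x₂ t) x₁) ∧
      (deriv (fun s => b₂ x₁ x₂ s) t
          + u₁ x₁ x₂ t * deriv (fun y => b₂ y x₂ t) x₁
          + u₂ x₁ x₂ t * deriv (fun y => b₂ x₁ y t) x₂
        = b₁ x₁ x₂ t * deriv (fun y => u₂ y x₂ t) x₁
          + b₂ x₁ x₂ t * deriv (fun y => u₂ x₁ y t) x₂
          + deriv (fun y => u₂ y x₂ t) x₁))
    (hinit : ∀ x₂ : ℝ, (∫ x₁ in (-π)..π, b₁ x₁ x₂ 0) = 0 ∧ (∫ x₁ in (-π)..π, b₂ x₁ x₂ 0) = 0)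
    (a : ℝ → ℝ → ℝ) (f₁ f₂ w₁ w₂ : ℝ → ℝ → ℝ → ℝ)
    (ha : ∀ x₂ t : ℝ, a x₂ t = (1 / (2 * π)) * ∫ y₁ in (-π)..π, b₁ y₁ x₂ t)
    (hf : ∀ x₁ x₂ t : ℝ,
      f₁ x₁ x₂ t = b₁ x₁ x₂ t - (1 / (2 * π)) * ∫ y₁ in (-π)..π, b₁ y₁ x₂ t ∧
      f₂ x₁ x₂ t = b₂ x₁ x₂ t - (1 / (2 * π)) * ∫ y₁ in (-π)..π, b₂ y₁ x₂ t)
    (hw : ∀ x₁ x₂ t : ℝ,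
      w₁ x₁ x₂ t = v₁ x₁ x₂ t - (1 / (2 * π)) * ∫ y₁ in (-π)..π, v₁ y₁ x₂ t ∧
      w₂ x₁ x₂ t = v₂ x₁ x₂ t - (1 / (2 * π)) * ∫ y₁ in (-π)..π, v₂ y₁ x₂ t) :
    (∀ x₂ t : ℝ, 0 ≤ t → (1 / (2 * π)) * (∫ x₁ in (-π)..π, b₂ x₁ x₂ t) = 0) ∧
    (∀ x₂ t : ℝ, 0 ≤ t →
      deriv (fun s => a x₂ s) t =
        deriv (fun y₂ => (1 / (2 * π)) * ∫ y₁ in (-π)..π,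
          (2 * f₂ y₁ y₂ t * deriv (fun z => f₁ z y₂ t) y₁
            + f₂ y₁ y₂ t * w₁ y₁ y₂ t - w₂ y₁ y₂ t * f₁ y₁ y₂ t)) x₂) := by
  have slice {ψ : ℝ → ℝ → ℝ → ℝ}
      (h : ContDiff ℝ (⊤ : ℕ∞) (fun q : ℝ × ℝ × ℝ => ψ q.1 q.2.1 q.2.2)) (t : ℝ) :
      SmoothPlane fun x y => ψ x y t :=
    h.comp (by fun_prop : ContDiff ℝ (⊤ : ℕ∞) fun q : ℝ × ℝ => (q.1, q.2, t))
  have sliceTime {ψ : ℝ → ℝ → ℝ → ℝ}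
      (h : ContDiff ℝ (⊤ : ℕ∞) (fun q : ℝ × ℝ × ℝ => ψ q.1 q.2.1 q.2.2)) (y : ℝ) :
      SmoothPlane fun x s => ψ x y s :=
    h.comp (by fun_prop : ContDiff ℝ (⊤ : ℕ∞) fun q : ℝ × ℝ => (q.1, y, q.2))
  have pb₁ := hper b₁ (by simp)
  have pb₂ := hper b₂ (by simp)
  have pv₁ := hper v₁ (by simp)
  have pv₂ := hper v₂ (by simp)
  have pp := hper p (by simp)
  obtain rfl : u₁ = fun x y t => partialFst (fun x y => b₁ x y t) x y + v₁ x y t :=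
    funext fun x => funext fun y => funext fun t => (hu x y t).1
  obtain rfl : u₂ = fun x y t => partialFst (fun x y => b₂ x y t) x y + v₂ x y t :=
    funext fun x => funext fun y => funext fun t => (hu x y t).2
  have su₁ (t : ℝ) : SmoothPlane fun x y => partialFst (fun x y => b₁ x y t) x y + v₁ x y t :=
    (slice hb₁ t).partialFst.add (slice hv₁ t)
  have su₂ (t : ℝ) : SmoothPlane fun x y => partialFst (fun x y => b₂ x y t) x y + v₂ x y t :=
    (slice hb₂ t).partialFst.add (slice hv₂ t)
  have pu₁ (t x y : ℝ) : partialFst (fun x y => b₁ x y t) (x + 2 * π) y + v₁ (x + 2 * π) y t =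
      partialFst (fun x y => b₁ x y t) x y + v₁ x y t := by
    rw [(pv₁ x y t).1, partialFst, deriv_add_period fun z => (pb₁ z y t).1]
  have pu₂ (t x y : ℝ) : partialFst (fun x y => b₂ x y t) (x + 2 * π) y + v₂ (x + 2 * π) y t =
      partialFst (fun x y => b₂ x y t) x y + v₂ x y t := by
    rw [(pv₂ x y t).1, partialFst, deriv_add_period fun z => (pb₂ z y t).1]
  have divu (t : ℝ) (ht : 0 ≤ t) := divergence_partialFst_add_eq_zero (slice hb₁ t) (slice hb₂ t)
    (slice hv₁ t) (slice hv₂ t) (fun x y => hdivb x y t ht) (fun x y => hdivv x y t ht)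
  have mean_b₂ (y t : ℝ) (ht : 0 ≤ t) : ∫ x in (-π)..π, b₂ x y t = 0 := by
    have hd (s : ℝ) (hs : 0 ≤ s) : HasDerivAt (fun s => ∫ x in (-π)..π, b₂ x y s) 0 s := by
      convert (sliceTime hb₂ y).hasDerivAt_integral (-π) π s using 1
      have sF : SmoothPlane fun x y =>
          b₁ x y s * (partialFst (fun x y => b₂ x y s) x y + v₂ x y s) -
            (partialFst (fun x y => b₁ x y s) x y + v₁ x y s) * b₂ x y s :=
        ((slice hb₁ s).mul (su₂ s)).sub ((su₁ s).mul (slice hb₂ s))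
      have e : (fun x => partialSnd (fun x s => b₂ x y s) x s) = fun x =>
          partialFst (fun x y =>
            b₁ x y s * (partialFst (fun x y => b₂ x y s) x y + v₂ x y s) -
              (partialFst (fun x y => b₁ x y s) x y + v₁ x y s) * b₂ x y s) x y +
          partialFst (fun x y => partialFst (fun x y => b₂ x y s) x y + v₂ x y s) x y := by
        funext x
        rw [induction_snd (slice hb₁ s) (slice hb₂ s) (su₁ s) (su₂ s)
          (fun x y => hdivb x y s hs) (divu s hs)]
        linarith [(hevol x y s hs).2]
      rw [e, intervalIntegral.integral_add
        ((sF.partialFst.continuous_fst y).intervalIntegrable _ _)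
        (((su₂ s).partialFst.continuous_fst y).intervalIntegrable _ _),
        sF.integral_partialFst_eq_zero fun x y => by
          simp only [pu₁, pu₂, (pb₁ x y s).1, (pb₂ x y s).1],
        (su₂ s).integral_partialFst_eq_zero (pu₂ s), add_zero]
    rw [← (hinit y).2]
    exact constant_of_has_deriv_right_zero (a := 0) (b := t)
      (fun s hs => (hd s hs.1).continuousAt.continuousWithinAt)
      (fun s hs => (hd s hs.1).hasDerivWithinAt) t ⟨ht, le_rfl⟩
  refine ⟨fun y t ht => by rw [mean_b₂ y t ht, mul_zero], fun y t ht => ?_⟩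
  have mean_v₂ (y : ℝ) : ∫ x in (-π)..π, v₂ x y t = 0 :=
    integral_snd_velocity_eq_zero (slice hb₁ t) (slice hb₂ t) (slice hv₁ t) (slice hv₂ t)
      (slice hp t) (fun x y => (pb₁ x y t).1) (fun x y => (pb₂ x y t).1)
      (fun x y => (pv₁ x y t).1) (fun x y => (pb₂ x y t).2) (fun x y => (pp x y t).2)
      (fun x y => hdivb x y t ht) (fun x y => hdivv x y t ht) (fun x y => (hv x y t ht).2) y
  have sF : SmoothPlane fun x y =>
      b₂ x y t * (partialFst (fun x y => b₁ x y t) x y + v₁ x y t) -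
        (partialFst (fun x y => b₂ x y t) x y + v₂ x y t) * b₁ x y t :=
    ((slice hb₂ t).mul (su₁ t)).sub ((su₂ t).mul (slice hb₁ t))
  have hflux (z : ℝ) : ∫ x in (-π)..π, (2 * f₂ x z t * deriv (fun z' => f₁ z' z t) x
        + f₂ x z t * w₁ x z t - w₂ x z t * f₁ x z t) =
      ∫ x in (-π)..π, (b₂ x z t * (partialFst (fun x y => b₁ x y t) x z + v₁ x z t) -
        (partialFst (fun x y => b₂ x y t) x z + v₂ x z t) * b₁ x z t) := by
    simp only [hf, hw, deriv_sub_const, mean_b₂ z t ht, mean_v₂ z, mul_zero, sub_zero]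
    exact (integral_flux_eq _ _ (fun x => (slice hb₁ t).hasDerivAt_fst x z)
      (fun x => (slice hb₂ t).hasDerivAt_fst x z) ((slice hb₁ t).partialFst.continuous_fst z)
      ((slice hb₂ t).partialFst.continuous_fst z) ((slice hv₁ t).continuous_fst z)
      ((slice hv₂ t).continuous_fst z) (fun x => (pb₁ x z t).1) (fun x => (pb₂ x z t).1)
      (mean_b₂ z t ht) (mean_v₂ z)).symm
  simp only [ha, hflux]
  rw [(((sliceTime hb₁ y).hasDerivAt_integral (-π) π t).const_mul _).deriv,
    ((sF.hasDerivAt_integral (-π) π y).const_mul _).deriv]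
  have e : (fun x => partialSnd (fun x s => b₁ x y s) x t) = fun x =>
      partialSnd (fun x y =>
        b₂ x y t * (partialFst (fun x y => b₁ x y t) x y + v₁ x y t) -
          (partialFst (fun x y => b₂ x y t) x y + v₂ x y t) * b₁ x y t) x y +
      partialFst (fun x y => partialFst (fun x y => b₁ x y t) x y + v₁ x y t) x y := by
    funext x
    rw [induction_fst (slice hb₁ t) (slice hb₂ t) (su₁ t) (su₂ t)
      (fun x y => hdivb x y t ht) (divu t ht)]
    linarith [(hevol x y t ht).1]
  rw [e, intervalIntegral.integral_add
    ((sF.partialSnd.continuous_fst y).intervalIntegrable _ _)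
    (((su₁ t).partialFst.continuous_fst y).intervalIntegrable _ _),
    (su₁ t).integral_partialFst_eq_zero (pu₁ t), add_zero]
end
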